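/- Let p be a prime with p ≡ 6 (mod 7) and p ≠ 13. Set φ₂ = f((2p−5)/7, (2p−5)/7, (p−6)/7) and φ₃ = f((3p−4)/7, (3p−4)/7, (5p−2)/7) in F_p[t] (the displayed quotients are integers since p ≡ 6 mod 7). Then there exists α ∈ F̄_p with α ≠ 0, 1 such that φ₂(α) = 0 and φ₃(α) ≠ 0, and there exists β ∈ F̄_p with β ≠ 0, 1 such that φ₃(β) = 0 and φ₂(β) ≠ 0. -/

import Mathlib

/-- `fabc p a b c = ∑_{i+j=c} C(a,i)·C(b,j)·t^i` in `F_p[t]`. -/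
noncomputable def fabc (p a b c : ℕ) : Polynomial (ZMod p) :=
  ∑ i ∈ Finset.range (c + 1),
    Polynomial.C ((a.choose i : ZMod p) * (b.choose (c - i) : ZMod p)) * Polynomial.X ^ i

open Polynomial

namespace Polynomial

theorem rootMultiplicity_le_one_of_ode {K : Type*} [Field K] (p : ℕ) [CharP K p]
    {F A B C : K[X]} {α : K} (hF : F ≠ 0) (hdeg : F.natDegree < p) (hA : A.eval α ≠ 0)
    (hode : A * derivative (derivative F) + B * derivative F + C * F = 0) :
    F.rootMultiplicity α ≤ 1 := by
  classical
  by_contra! hm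
  obtain ⟨G, hFG, hG⟩ := exists_eq_pow_rootMultiplicity_mul_and_not_dvd F hF α
  have hmp : F.rootMultiplicity α < p :=
    (count_roots F ▸ (Multiset.count_le_card α F.roots).trans (card_roots' F)).trans_lt hdeg
  obtain ⟨m, hm⟩ := Nat.exists_eq_add_of_le hm
  rw [hm, Nat.succ_eq_add_one, show 1 + 1 + m = m + 2 by ring] at hFG
  rw [hm] at hmp
  have hcast : ∀ j, 0 < j → j < p → (j : K) ≠ 0 := fun j h0 hj h =>
    absurd (Nat.le_of_dvd h0 ((CharP.cast_eq_zero_iff K p j).1 h)) (by omega)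
  have h1 := hcast (m + 2) (by omega) (by omega)
  have h2 := hcast (m + 1) (by omega) (by omega)
  have hGα : G.eval α ≠ 0 := fun h => hG (dvd_iff_isRoot.2 h)
  have hX : (X - Polynomial.C α) ≠ 0 := X_sub_C_ne_zero α
  have key : (X - Polynomial.C α) ^ m *
      (A * (((m : K[X]) + 2) * ((m : K[X]) + 1) * G + (X - Polynomial.C α) *
          (2 * ((m : K[X]) + 2) * derivative G + (X - Polynomial.C α) * derivative (derivative G))) +
        (X - Polynomial.C α) * (B * (((m : K[X]) + 2) * G + (X - Polynomial.C α) * derivative G) +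
          (X - Polynomial.C α) * C * G)) = 0 := by
    rw [← hode, hFG]
    simp only [derivative_mul, derivative_X_sub_C_pow, derivative_natCast,
      Nat.add_sub_cancel, show m + 2 - 1 = m + 1 by omega, Nat.cast_add,
      map_add, map_natCast, Nat.cast_ofNat, Nat.cast_one, map_one, map_ofNat,
      derivative_ofNat]
    ring
  have := congrArg (eval α) ((mul_eq_zero.1 key).resolve_left (pow_ne_zero m hX))
  simp only [eval_add, eval_mul, eval_sub, eval_X, eval_C, sub_self, zero_mul, add_zero,
    eval_natCast, eval_one, eval_ofNat, eval_zero] at this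
  push_cast at h1 h2
  exact mul_ne_zero hA (mul_ne_zero (mul_ne_zero h1 h2) hGα) this

theorem coeff_mul_coeff_comm_of_roots_subset {K : Type*} [Field K] [IsAlgClosed K] {F G : K[X]}
    (hG : G ≠ 0) (hdeg : G.natDegree ≤ F.natDegree)
    (hsimple : ∀ α, F.IsRoot α → F.rootMultiplicity α ≤ 1) (hroots : ∀ α, F.IsRoot α → G.IsRoot α)
    (i j : ℕ) : F.coeff i * G.coeff j = F.coeff j * G.coeff i := by
  classical
  rcases eq_or_ne F 0 with rfl | hF
  · simp
  have hle : F.roots ≤ G.roots := by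
    refine (Multiset.le_iff_subset (Multiset.nodup_iff_count_le_one.2 fun α => ?_)).2 fun α hα => ?_
    · rw [count_roots]
      by_cases h : F.IsRoot α
      · exact hsimple α h
      · simp [rootMultiplicity_eq_zero h]
    · exact (mem_roots hG).2 (hroots α (isRoot_of_mem_roots hα))
  obtain ⟨H, rfl⟩ := (IsAlgClosed.splits F).dvd_of_roots_le_roots hF hle
  have hH : H ≠ 0 := right_ne_zero_of_mul hG
  rw [natDegree_mul hF hH] at hdeg
  rw [eq_C_of_natDegree_eq_zero (show H.natDegree = 0 by omega)]
  simp only [coeff_mul_C]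
  ring

end Polynomial

theorem Nat.Prime.not_dvd_choose_of_lt {p n k : ℕ} (hp : p.Prime) (hn : n < p) (hk : k ≤ n) :
    ¬ p ∣ n.choose k := fun h =>
  absurd (hp.dvd_factorial.1 <| h.trans <|
    ⟨k.factorial * (n - k).factorial, by rw [← mul_assoc, Nat.choose_mul_factorial_mul_factorial hk]⟩)
    (by omega)

section fabc

variable (p : ℕ)

theorem fabc_coeff (a b c i : ℕ) : (fabc p a b c).coeff i =
    if i ≤ c then (a.choose i : ZMod p) * (b.choose (c - i) : ZMod p) else 0 := by
  simp only [fabc, finsetSum_coeff, coeff_C_mul, coeff_X_pow, mul_ite, mul_one, mul_zero,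
    Finset.sum_ite_eq, Finset.mem_range, Nat.lt_succ_iff]

theorem fabc_coeff_succ {n c : ℕ} (hc : c ≤ n) (i : ℕ) :
    ((i : ZMod p) + 1) * (i + 1 + n - c) * (fabc p n n c).coeff (i + 1) =
      (n - i) * (c - i) * (fabc p n n c).coeff i := by
  simp only [fabc_coeff]
  rcases lt_trichotomy i c with h | rfl | h
  · obtain ⟨d, rfl⟩ := Nat.exists_eq_add_of_lt h
    obtain ⟨e, rfl⟩ := Nat.exists_eq_add_of_le hc
    rw [if_pos (by omega), if_pos (by omega), show i + d + 1 - (i + 1) = d by omega,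
      show i + d + 1 - i = d + 1 by omega]
    have h1 := congrArg (Nat.cast (R := ZMod p)) (Nat.choose_succ_right_eq (i + d + 1 + e) i)
    have h2 := congrArg (Nat.cast (R := ZMod p)) (Nat.choose_succ_right_eq (i + d + 1 + e) d)
    rw [show i + d + 1 + e - i = d + 1 + e by omega] at h1
    rw [show i + d + 1 + e - d = i + 1 + e by omega] at h2
    push_cast at h1 h2 ⊢
    linear_combination (i + 1 + e : ZMod p) * ((i + d + 1 + e).choose d) * h1 -
      (d + 1 + e : ZMod p) * ((i + d + 1 + e).choose i) * h2
  · simp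
  · rw [if_neg (by omega), if_neg (by omega)]
    simp

theorem fabc_ode {n c : ℕ} (hc : c ≤ n) :
    X * (1 - X) * derivative (derivative (fabc p n n c)) +
      ((1 + n - c : (ZMod p)[X]) - (1 - n - c : (ZMod p)[X]) * X) * derivative (fabc p n n c) +
      (-(n * c : (ZMod p)[X])) * fabc p n n c = 0 := by
  have e1 (F : (ZMod p)[X]) (A : ZMod p) (B : ZMod p) (D : ZMod p) (i : ℕ) :
      (X * (1 - X) * derivative (derivative F) + (C A - C B * X) * derivative F + C D * F).coeff i
      = (i + 1) * (i + A) * F.coeff (i + 1) + (-(i * (i - 1)) - i * B + D) * F.coeff i := by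
    have : X * (1 - X) * derivative (derivative F) + (C A - C B * X) * derivative F + C D * F =
        derivative (derivative F) * X - derivative (derivative F) * X * X + C A * derivative F
        - C B * (derivative F * X) + C D * F := by ring
    rw [this]
    simp only [coeff_add, coeff_sub, coeff_C_mul]
    rcases i with _ | _ | i
    · simp [coeff_derivative, mul_coeff_zero]
    · simp [coeff_derivative, coeff_mul_X, mul_coeff_zero]
      ring
    · simp only [coeff_mul_X, coeff_derivative]
      push_cast
      ring
  have e2 := e1 (fabc p n n c) (1 + n - c) (1 - n - c) (-(n * c))
  simp only [map_add, map_sub, map_neg, map_mul, map_natCast, map_one] at e2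
  ext i
  rw [e2, coeff_zero]
  linear_combination fabc_coeff_succ p hc i

theorem fabc_eval_one (a b c : ℕ) : (fabc p a b c).eval 1 = ((a + b).choose c : ZMod p) := by
  rw [Nat.add_choose_eq, Finset.Nat.sum_antidiagonal_eq_sum_range_succ_mk]
  simp [fabc, eval_finsetSum]

theorem fabc_natDegree_le (a b c : ℕ) : (fabc p a b c).natDegree ≤ c :=
  natDegree_le_iff_coeff_eq_zero.2 fun i hi => by rw [fabc_coeff, if_neg (by omega)]

theorem fabc_eq_X_pow_mul (n d c : ℕ) (h : n = d + c) :
    fabc p n n (n + d) = X ^ d * fabc p n n c := by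
  subst h
  ext i
  rw [coeff_X_pow_mul', fabc_coeff, fabc_coeff]
  by_cases hi : d ≤ i
  · obtain ⟨j, rfl⟩ := Nat.exists_eq_add_of_le hi
    rw [if_pos hi, Nat.add_sub_cancel_left]
    by_cases hj : j ≤ c
    · rw [if_pos hj, if_pos (by omega), ← Nat.choose_symm (show d + j ≤ d + c by omega),
        show d + c - (d + j) = c - j by omega, show d + c + d - (d + j) = d + c - j by omega,
        Nat.choose_symm (show j ≤ d + c by omega), mul_comm]
    · rw [if_neg hj, Nat.choose_eq_zero_of_lt (show d + c < d + j by omega)]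
      simp
  · rw [if_neg hi, Nat.choose_eq_zero_of_lt (show d + c < d + c + d - i by omega)]
    simp

variable [Fact p.Prime]

theorem fabc_natDegree {n c : ℕ} (hc : c ≤ n) (hn : n < p) : (fabc p n n c).natDegree = c := by
  refine natDegree_eq_of_le_of_coeff_ne_zero (fabc_natDegree_le p n n c) ?_
  rw [fabc_coeff, if_pos le_rfl]
  simpa [CharP.cast_eq_zero_iff (ZMod p) p] using
    (Fact.out : p.Prime).not_dvd_choose_of_lt hn hc

theorem fabc_coeff_zero_ne_zero {n c : ℕ} (hc : c ≤ n) (hn : n < p) :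
    (fabc p n n c).coeff 0 ≠ 0 := by
  simpa [fabc_coeff, CharP.cast_eq_zero_iff (ZMod p) p] using
    (Fact.out : p.Prime).not_dvd_choose_of_lt hn hc

variable {K : Type*} [Field K] [Algebra (ZMod p) K]

theorem ne_zero_and_ne_one_of_fabc_root {n c : ℕ} (hc : c ≤ n) (hn : 2 * n < p) {α : K}
    (hα : aeval α (fabc p n n c) = 0) : α ≠ 0 ∧ α ≠ 1 := by
  constructor
  · rintro rfl
    rw [← coeff_zero_eq_aeval_zero'] at hα
    exact fabc_coeff_zero_ne_zero p hc (by omega) (by simpa using hα)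
  · rintro rfl
    rw [← map_one (algebraMap (ZMod p) K), aeval_algebraMap_apply, coe_aeval_eq_eval,
      fabc_eval_one, map_eq_zero, CharP.cast_eq_zero_iff (ZMod p) p] at hα
    exact (Fact.out : p.Prime).not_dvd_choose_of_lt (by omega) (by omega) hα

theorem exists_fabc_root_not_root [IsAlgClosed K] {n m c : ℕ} (hn : c ≤ n) (hn' : 2 * n < p)
    (hm : c ≤ m) (hm' : 2 * m < p)
    (hne : (fabc p n n c).coeff 0 * (fabc p m m c).coeff 1 ≠
      (fabc p n n c).coeff 1 * (fabc p m m c).coeff 0) :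
    ∃ α : K, aeval α (fabc p n n c) = 0 ∧ aeval α (fabc p m m c) ≠ 0 := by
  have : CharP K p := charP_of_injective_algebraMap (algebraMap (ZMod p) K).injective p
  by_contra! h
  have hF0 : fabc p n n c ≠ 0 := fun h0 =>
    fabc_coeff_zero_ne_zero p hn (by omega) (by rw [h0, coeff_zero])
  have hG0 : fabc p m m c ≠ 0 := fun h0 =>
    fabc_coeff_zero_ne_zero p hm (by omega) (by rw [h0, coeff_zero])
  have key := coeff_mul_coeff_comm_of_roots_subset
    (F := (fabc p n n c).map (algebraMap (ZMod p) K))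
    (G := (fabc p m m c).map (algebraMap (ZMod p) K))
    (by simpa using hG0)
    (by rw [natDegree_map, natDegree_map, fabc_natDegree p hn (by omega),
      fabc_natDegree p hm (by omega)])
    (fun α hα => by
      rw [IsRoot, eval_map_algebraMap] at hα
      obtain ⟨h0, h1⟩ := ne_zero_and_ne_one_of_fabc_root p hn hn' hα
      have hode := congrArg (Polynomial.map (algebraMap (ZMod p) K)) (fabc_ode p hn)
      simp only [Polynomial.map_add, Polynomial.map_mul, Polynomial.map_zero,
        ← derivative_map] at hode
      refine rootMultiplicity_le_one_of_ode p (by simpa using hF0) ?_ ?_ hode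
      · rw [natDegree_map, fabc_natDegree p hn (by omega)]
        omega
      · simpa [sub_eq_zero] using ⟨h0, h1.symm⟩)
    (fun α hα => by
      rw [IsRoot, eval_map_algebraMap] at hα ⊢
      exact h α hα) 0 1
  simp only [coeff_map, ← map_mul] at key
  exact hne ((algebraMap (ZMod p) K).injective key)

end fabc

theorem fabc_coeff_cross_ne {p k : ℕ} [Fact p.Prime] (hp : p = 7 * k + 6) (hk : 1 < k) :
    (fabc p (2 * k + 1) (2 * k + 1) k).coeff 0 * (fabc p (3 * k + 2) (3 * k + 2) k).coeff 1 ≠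
      (fabc p (2 * k + 1) (2 * k + 1) k).coeff 1 * (fabc p (3 * k + 2) (3 * k + 2) k).coeff 0 := by
  intro h
  have hF := fabc_coeff_zero_ne_zero p (n := 2 * k + 1) (c := k) (by omega) (by omega)
  have hG := fabc_coeff_zero_ne_zero p (n := 3 * k + 2) (c := k) (by omega) (by omega)
  have h1 := fabc_coeff_succ p (n := 2 * k + 1) (c := k) (by omega) 0
  have h2 := fabc_coeff_succ p (n := 3 * k + 2) (c := k) (by omega) 0
  push_cast at h1 h2
  rw [zero_add] at h1 h2
  have hcast : ∀ j, 0 < j → j < p → (j : ZMod p) ≠ 0 := fun j h0 hj h =>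
    absurd (Nat.le_of_dvd h0 ((CharP.cast_eq_zero_iff (ZMod p) p j).1 h)) (by omega)
  have hk0 := hcast k (by omega) (by omega)
  have hk1 := hcast (k + 1) (by omega) (by omega)
  have hk2 := hcast (k - 1) (by omega) (by omega)
  rw [Nat.cast_sub hk.le] at hk2
  push_cast at hk1 hk2
  refine mul_ne_zero (mul_ne_zero hF hG) (mul_ne_zero hk0 (mul_ne_zero hk1 hk2)) ?_
  linear_combination (-(k + 2) * (2 * k + 3) : ZMod p) * h +
    (k + 2 : ZMod p) * (fabc p (2 * k + 1) (2 * k + 1) k).coeff 0 * h2 -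
    (2 * k + 3 : ZMod p) * (fabc p (3 * k + 2) (3 * k + 2) k).coeff 0 * h1

/-- The `p ≡ 6 (mod 7)` case of Lemma `p equiv mo`: for a prime `p ≡ 6 (mod 7)`, `p ≠ 13`,
with `φ₂ = f((2p-5)/7, (2p-5)/7, (p-6)/7)` and `φ₃ = f((3p-4)/7, (3p-4)/7, (5p-2)/7)`,
there is `α ∈ F̄_p ∖ {0,1}` with `φ₂(α) = 0 ≠ φ₃(α)`, and `β ∈ F̄_p ∖ {0,1}` with
`φ₃(β) = 0 ≠ φ₂(β)`. -/
theorem stmt_16 (p : ℕ) [Fact p.Prime] (hmod : p % 7 = 6) (hp13 : p ≠ 13) :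
    (∃ α : AlgebraicClosure (ZMod p), α ≠ 0 ∧ α ≠ 1 ∧
      Polynomial.aeval α (fabc p ((2 * p - 5) / 7) ((2 * p - 5) / 7) ((p - 6) / 7)) = 0 ∧
      Polynomial.aeval α (fabc p ((3 * p - 4) / 7) ((3 * p - 4) / 7) ((5 * p - 2) / 7)) ≠ 0) ∧
    (∃ β : AlgebraicClosure (ZMod p), β ≠ 0 ∧ β ≠ 1 ∧
      Polynomial.aeval β (fabc p ((3 * p - 4) / 7) ((3 * p - 4) / 7) ((5 * p - 2) / 7)) = 0 ∧
      Polynomial.aeval β (fabc p ((2 * p - 5) / 7) ((2 * p - 5) / 7) ((p - 6) / 7)) ≠ 0) := by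
  obtain ⟨k, hp⟩ : ∃ k, p = 7 * k + 6 := ⟨p / 7, by omega⟩
  have hk : 1 < k := by
    rcases k with _ | _ | k
    · exact absurd (hp ▸ (Fact.out : p.Prime)) (by norm_num)
    · omega
    · omega
  rw [show (2 * p - 5) / 7 = 2 * k + 1 by omega, show (p - 6) / 7 = k by omega,
    show (3 * p - 4) / 7 = 3 * k + 2 by omega,
    show (5 * p - 2) / 7 = 3 * k + 2 + (2 * k + 2) by omega,
    fabc_eq_X_pow_mul p (3 * k + 2) (2 * k + 2) k (by omega)]
  have hne := fabc_coeff_cross_ne hp hk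
  simp only [map_mul, map_pow, aeval_X]
  constructor
  · obtain ⟨α, hα, hα'⟩ := exists_fabc_root_not_root (K := AlgebraicClosure (ZMod p)) p
      (n := 2 * k + 1) (m := 3 * k + 2) (c := k)
      (by omega) (by omega) (by omega) (by omega) hne
    obtain ⟨h0, h1⟩ := ne_zero_and_ne_one_of_fabc_root p (n := 2 * k + 1) (c := k) (by omega) (by omega) hα
    exact ⟨α, h0, h1, hα, mul_ne_zero (pow_ne_zero _ h0) hα'⟩
  · obtain ⟨β, hβ, hβ'⟩ := exists_fabc_root_not_root (K := AlgebraicClosure (ZMod p)) p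
      (n := 3 * k + 2) (m := 2 * k + 1) (c := k)
      (by omega) (by omega) (by omega) (by omega)
      (fun h => hne (by linear_combination -h))
    obtain ⟨h0, h1⟩ := ne_zero_and_ne_one_of_fabc_root p (n := 3 * k + 2) (c := k) (by omega) (by omega) hβ
    exact ⟨β, h0, h1, by rw [hβ, mul_zero], hβ'⟩
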